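/- (Eaves-type theorem) Suppose the quadratic form x ↦ ⟨x, T x⟩ is a Legendre form and that: (i) F is nonempty; (ii) ⟨v, T v⟩ ≥ 0 for all v ∈ 0⁺F; (iii) if v ∈ 0⁺F and x ∈ F satisfy ⟨v, T v⟩ = 0, then ⟨T x + c, v⟩ ≥ 0; (iv) condition (A) holds. Then f attains its infimum on F. -/

import Mathlib

open scoped RealInnerProductSpace
open Filter Topology

/-- A sequence `x` in a real inner product space converges weakly to `x₀` if
`⟪a, x k⟫ → ⟪a, x₀⟫` for every `a`. -/
def WeaklyConvergesTo {H : Type*} [NormedAddCommGroup H] [InnerProductSpace ℝ H]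
    (x : ℕ → H) (x₀ : H) : Prop :=
  ∀ a : H, Tendsto (fun k => ⟪a, x k⟫) atTop (𝓝 ⟪a, x₀⟫)

/-- The quadratic form `x ↦ ⟪x, T x⟫` is a Legendre form: it is weakly sequentially lower
semicontinuous, and `x k → x₀` strongly whenever `x k ⇀ x₀` and `⟪x k, T (x k)⟫ → ⟪x₀, T x₀⟫`. -/
def IsLegendreForm {H : Type*} [NormedAddCommGroup H] [InnerProductSpace ℝ H]
    (T : H →L[ℝ] H) : Prop :=
  (∀ (x : ℕ → H) (x₀ : H), WeaklyConvergesTo x x₀ →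
      ⟪x₀, T x₀⟫ ≤ Filter.liminf (fun k => ⟪x k, T (x k)⟫) Filter.atTop) ∧
  (∀ (x : ℕ → H) (x₀ : H), WeaklyConvergesTo x x₀ →
      Tendsto (fun k => ⟪x k, T (x k)⟫) atTop (𝓝 ⟪x₀, T x₀⟫) →
      Tendsto x atTop (𝓝 x₀))

/-- The recession cone `0⁺X = {v | x + t • v ∈ X for all x ∈ X and t ≥ 0}`. -/
def recessionCone {H : Type*} [NormedAddCommGroup H] [InnerProductSpace ℝ H]
    (X : Set H) : Set H :=
  {v | ∀ x ∈ X, ∀ t : ℝ, 0 ≤ t → x + t • v ∈ X}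

section

variable {H : Type*} [NormedAddCommGroup H] [InnerProductSpace ℝ H]

namespace WeaklyConvergesTo

theorem comp {x : ℕ → H} {x₀ : H} (h : WeaklyConvergesTo x x₀) {φ : ℕ → ℕ}
    (hφ : StrictMono φ) : WeaklyConvergesTo (x ∘ φ) x₀ :=
  fun a => (h a).comp hφ.tendsto_atTop

theorem norm_le {x : ℕ → H} {x₀ : H} (h : WeaklyConvergesTo x x₀) {R : ℝ}
    (hR : ∀ n, ‖x n‖ ≤ R) : ‖x₀‖ ≤ R := by
  have h1 : ⟪x₀, x₀⟫ ≤ ‖x₀‖ * R :=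
    le_of_tendsto (h x₀) (Eventually.of_forall fun n =>
      (real_inner_le_norm _ _).trans (mul_le_mul_of_nonneg_left (hR n) (norm_nonneg _)))
  rw [real_inner_self_eq_norm_mul_norm] at h1
  by_contra! hlt
  have h0 : 0 ≤ R := (norm_nonneg _).trans (hR 0)
  nlinarith

theorem eventually_lt_norm_sq {x : ℕ → H} {x₀ : H} (h : WeaklyConvergesTo x x₀) {δ : ℝ}
    (hδ : 0 < δ) : ∀ᶠ n in atTop, ‖x₀‖ ^ 2 - δ < ‖x n‖ ^ 2 := by
  have h1 := h x₀
  rw [real_inner_self_eq_norm_sq] at h1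
  filter_upwards [h1.eventually (lt_mem_nhds (show ‖x₀‖ ^ 2 - δ / 2 < ‖x₀‖ ^ 2 by linarith))]
    with n hn
  have h2 := norm_sub_sq_real x₀ (x n)
  nlinarith [sq_nonneg ‖x₀ - x n‖]

end WeaklyConvergesTo

/-- Bounded sequences in a real Hilbert space have weakly convergent subsequences. -/
theorem exists_subseq_weaklyConvergesTo [CompleteSpace H] {x : ℕ → H} {R : ℝ}
    (hR : ∀ n, ‖x n‖ ≤ R) :
    ∃ (x₀ : H) (φ : ℕ → ℕ), StrictMono φ ∧ WeaklyConvergesTo (x ∘ φ) x₀ := by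
  let K : Submodule ℝ H := (Submodule.span ℝ (Set.range x)).topologicalClosure
  have hxK : ∀ n, x n ∈ K := fun n =>
    Submodule.le_topologicalClosure _ (Submodule.subset_span ⟨n, rfl⟩)
  have : CompleteSpace K :=
    (Submodule.isClosed_topologicalClosure _).completeSpace_coe
  have hsep : TopologicalSpace.IsSeparable (K : Set H) := by
    rw [Submodule.topologicalClosure_coe]
    exact ((Set.countable_range x).isSeparable.span (R := ℝ)).closure
  have : TopologicalSpace.SeparableSpace K := hsep.separableSpace
  let y : ℕ → K := fun n => ⟨x n, hxK n⟩
  let w : ℕ → WeakDual ℝ K := fun n =>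
    StrongDual.toWeakDual (InnerProductSpace.toDual ℝ K (y n))
  have hw : ∀ n, w n ∈ WeakDual.toStrongDual ⁻¹' Metric.closedBall (0 : StrongDual ℝ K) R := by
    intro n
    have : ‖InnerProductSpace.toDual ℝ K (y n)‖ ≤ R := by
      rw [LinearIsometryEquiv.norm_map]
      exact hR n
    exact mem_closedBall_zero_iff.2 this
  obtain ⟨g, -, φ, hφ, hg⟩ := WeakDual.isSeqCompact_closedBall ℝ K 0 R hw
  let z : K := (InnerProductSpace.toDual ℝ K).symm (WeakDual.toStrongDual g)
  refine ⟨z, φ, hφ, fun a => ?_⟩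
  have h1 := ((WeakDual.eval_continuous (𝕜 := ℝ) (K.orthogonalProjectionOnto a)).tendsto g).comp hg
  have h2 : ∀ u : K, ⟪a, (u : H)⟫ = ⟪u, K.orthogonalProjectionOnto a⟫ := fun u => by
    rw [← Submodule.inner_orthogonalProjectionOnto_eq_of_mem_right, real_inner_comm]
  have h3 : ⟪z, K.orthogonalProjectionOnto a⟫ = g (K.orthogonalProjectionOnto a) := by
    exact InnerProductSpace.toDual_symm_apply
  rw [h2, h3]
  refine h1.congr fun n => ?_
  change (w (φ n)) _ = ⟪a, ((y (φ n) : K) : H)⟫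
  rw [h2]
  rfl

/-- A weakly sequentially lower semicontinuous function attains its minimum on a nonempty bounded
weakly sequentially closed set on which it is bounded below. -/
theorem exists_forall_le_of_weakly_lsc [CompleteSpace H] {K : Set H} {R : ℝ} {h : H → ℝ}
    (hne : K.Nonempty) (hR : ∀ x ∈ K, ‖x‖ ≤ R)
    (hK : ∀ (x : ℕ → H) (x₀ : H), WeaklyConvergesTo x x₀ → (∀ n, x n ∈ K) → x₀ ∈ K)
    (hbdd : BddBelow (h '' K))
    (hlsc : ∀ (x : ℕ → H) (x₀ : H), WeaklyConvergesTo x x₀ → (∀ n, x n ∈ K) →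
      ∀ δ > 0, ∀ᶠ n in atTop, h x₀ - δ < h (x n)) :
    ∃ x ∈ K, ∀ y ∈ K, h x ≤ h y := by
  obtain ⟨u, -, hu, huK⟩ := exists_seq_tendsto_sInf (hne.image h) hbdd
  choose x hxK hxu using huK
  obtain ⟨x₀, φ, hφ, hx₀⟩ := exists_subseq_weaklyConvergesTo fun n => hR _ (hxK n)
  refine ⟨x₀, hK _ _ hx₀ fun n => hxK _, fun y hy => ?_⟩
  refine le_trans (le_of_forall_pos_le_add fun δ hδ => ?_) (csInf_le hbdd ⟨y, hy, rfl⟩)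
  have h1 : Tendsto (fun n => h (x (φ n))) atTop (𝓝 (sInf (h '' K))) := by
    simpa only [hxu, Function.comp_def] using hu.comp hφ.tendsto_atTop
  have h2 := ge_of_tendsto h1 ((hlsc _ _ hx₀ (fun n => hxK _) δ hδ).mono fun n hn => hn.le)
  linarith

theorem neg_le_inner_apply (T : H →L[ℝ] H) {x : H} {R : ℝ} (hx : ‖x‖ ≤ R) :
    -(‖T‖ * R ^ 2) ≤ ⟪x, T x⟫ := by
  have h1 := neg_le_of_abs_le (abs_real_inner_le_norm x (T x))
  have h2 : ‖x‖ * ‖T x‖ ≤ R * (‖T‖ * R) := by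
    have := (norm_nonneg x).trans hx
    gcongr
    exact T.le_opNorm_of_le hx
  nlinarith

theorem IsLegendreForm.eventually_lt {T : H →L[ℝ] H} (hT : IsLegendreForm T) {x : ℕ → H} {x₀ : H}
    (h : WeaklyConvergesTo x x₀) {R : ℝ} (hR : ∀ n, ‖x n‖ ≤ R) {δ : ℝ} (hδ : 0 < δ) :
    ∀ᶠ n in atTop, ⟪x₀, T x₀⟫ - δ < ⟪x n, T (x n)⟫ :=
  eventually_lt_of_lt_liminf ((sub_lt_self _ hδ).trans_le (hT.1 x x₀ h))
    (isBoundedUnder_of ⟨_, fun n => neg_le_inner_apply T (hR n)⟩)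

theorem inner_add_smul_apply {S : H →L[ℝ] H} (hS : ∀ x y : H, ⟪S x, y⟫ = ⟪x, S y⟫) (x v : H)
    (t : ℝ) :
    ⟪x + t • v, S (x + t • v)⟫ = ⟪x, S x⟫ + 2 * t * ⟪S x, v⟫ + t ^ 2 * ⟪v, S v⟫ := by
  have : ⟪v, S x⟫ = ⟪S x, v⟫ := real_inner_comm _ _
  simp only [map_add, map_smul, inner_add_left, inner_add_right, real_inner_smul_left,
    real_inner_smul_right, this, ← hS x v]
  ring

theorem apply_eq_zero_of_inner_eq_zero {S : H →L[ℝ] H} (hS : ∀ x y : H, ⟪S x, y⟫ = ⟪x, S y⟫)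
    (hpos : ∀ x : H, 0 ≤ ⟪x, S x⟫) {v : H} (hv : ⟪v, S v⟫ = 0) : S v = 0 := by
  have key : ∀ x : H, ⟪S x, v⟫ = 0 := by
    intro x
    by_contra hne
    have h := hpos (x + (-(⟪x, S x⟫ + 1) / (2 * ⟪S x, v⟫)) • v)
    have h1 : 2 * (-(⟪x, S x⟫ + 1) / (2 * ⟪S x, v⟫)) * ⟪S x, v⟫ = -(⟪x, S x⟫ + 1) := by
      field_simp
    rw [inner_add_smul_apply hS, hv, h1] at h
    linarith
  have h := key (S v)
  rwa [hS, inner_self_eq_zero] at h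

/-- Sublevel sets of convex quadratic functions are weakly sequentially closed. -/
theorem quadratic_le_zero_of_weaklyConvergesTo {S : H →L[ℝ] H}
    (hS : ∀ x y : H, ⟪S x, y⟫ = ⟪x, S y⟫) (hpos : ∀ x : H, 0 ≤ ⟪x, S x⟫) {b : H} {a : ℝ}
    {x : ℕ → H} {x₀ : H} (h : WeaklyConvergesTo x x₀)
    (hx : ∀ᶠ n in atTop, (1/2 : ℝ) * ⟪x n, S (x n)⟫ + ⟪b, x n⟫ + a ≤ 0) :
    (1/2 : ℝ) * ⟪x₀, S x₀⟫ + ⟪b, x₀⟫ + a ≤ 0 := by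
  have h1 := (((h (S x₀)).sub_const ((1/2 : ℝ) * ⟪x₀, S x₀⟫)).add (h b)).add_const a
  have h2 := le_of_tendsto (b := 0) h1 <| hx.mono fun n hn => by
    have h3 := hpos (x₀ + (-1 : ℝ) • x n)
    rw [inner_add_smul_apply hS] at h3
    linarith
  rw [hS x₀ x₀] at h2
  linarith

theorem convex_quadratic_le_zero {S : H →L[ℝ] H}
    (hS : ∀ x y : H, ⟪S x, y⟫ = ⟪x, S y⟫) (hpos : ∀ x : H, 0 ≤ ⟪x, S x⟫) (b : H) (a : ℝ) :
    Convex ℝ {x : H | (1/2 : ℝ) * ⟪x, S x⟫ + ⟪b, x⟫ + a ≤ 0} := by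
  intro x hx y hy p q hp hq hpq
  simp only [Set.mem_ofPred_eq] at *
  obtain rfl : p = 1 - q := by linarith
  obtain ⟨d, rfl⟩ : ∃ d, y = x + (1 : ℝ) • d := ⟨y - x, by module⟩
  have h1 : (1 - q) • x + q • (x + (1 : ℝ) • d) = x + q • d := by module
  rw [h1]
  rw [inner_add_smul_apply hS, inner_add_right, real_inner_smul_right] at hy ⊢
  nlinarith [mul_nonneg (mul_nonneg hp hq) (hpos d), mul_nonpos_of_nonneg_of_nonpos hp hx,
    mul_nonpos_of_nonneg_of_nonpos hq hy]

/-- Weak limits of normalized unbounded sequences in a convex weakly sequentially closed set are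
recession directions. -/
theorem mem_recessionCone_of_weaklyConvergesTo {F : Set H} (hconv : Convex ℝ F)
    (hclosed : ∀ (x : ℕ → H) (x₀ : H), WeaklyConvergesTo x x₀ → (∀ᶠ n in atTop, x n ∈ F) → x₀ ∈ F)
    {y : ℕ → H} (hy : ∀ n, y n ∈ F) (hnorm : Tendsto (fun n => ‖y n‖) atTop atTop) {v : H}
    (hv : WeaklyConvergesTo (fun n => ‖y n‖⁻¹ • y n) v) : v ∈ recessionCone F := by
  intro x hx t ht
  refine hclosed (fun n => (1 - t * ‖y n‖⁻¹) • x + (t * ‖y n‖⁻¹) • y n) _ (fun a => ?_) ?_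
  · have h1 : Tendsto (fun n => t * ‖y n‖⁻¹) atTop (𝓝 0) := by
      simpa using (tendsto_inv_atTop_zero.comp hnorm).const_mul t
    have h2 := ((h1.const_sub 1).mul_const ⟪a, x⟫).add ((hv a).const_mul t)
    simp only [sub_zero, one_mul] at h2
    rw [inner_add_right, real_inner_smul_right]
    refine h2.congr fun n => ?_
    simp only [inner_add_right, real_inner_smul_right]
    ring
  · filter_upwards [hnorm.eventually_ge_atTop (t + 1)] with n hn
    have h0 : 0 < ‖y n‖ := by linarith
    refine hconv hx (hy n) ?_ (by positivity) (by ring)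
    rw [sub_nonneg, ← div_eq_mul_inv, div_le_one h0]
    linarith

theorem inner_apply_eq_zero_of_mem_recessionCone {S : H →L[ℝ] H}
    (hS : ∀ x y : H, ⟪S x, y⟫ = ⟪x, S y⟫) (hpos : ∀ x : H, 0 ≤ ⟪x, S x⟫) {b : H} {a : ℝ}
    {F : Set H} (hne : F.Nonempty) (hF : ∀ x ∈ F, (1/2 : ℝ) * ⟪x, S x⟫ + ⟪b, x⟫ + a ≤ 0) {v : H}
    (hv : v ∈ recessionCone F) : ⟪v, S v⟫ = 0 := by
  obtain ⟨x, hx⟩ := hne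
  by_contra hne
  have hp : 0 < ⟪v, S v⟫ := lt_of_le_of_ne (hpos v) (Ne.symm hne)
  set q := ⟪v, S v⟫ with hq
  set l := ⟪S x, v⟫ + ⟪b, v⟫ with hl
  set g := (1/2 : ℝ) * ⟪x, S x⟫ + ⟪b, x⟫ + a with hg
  have h1 : ∀ t : ℝ, 0 ≤ t → g + t * (l + t * q / 2) ≤ 0 := by
    intro t ht
    have h := hF _ (hv x hx t ht)
    rw [inner_add_smul_apply hS, inner_add_right, real_inner_smul_right] at h
    rw [hg, hl]
    linarith
  have h2 := h1 (2 * (|l| + 1) / q + |g|) (by positivity)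
  have h3 : (2 * (|l| + 1) / q + |g|) * q / 2 = |l| + 1 + |g| * q / 2 := by
    field_simp
  rw [h3] at h2
  have h4 : 0 < 2 * (|l| + 1) / q := by positivity
  have h5 : 1 ≤ l + (|l| + 1 + |g| * q / 2) := by
    have : 0 ≤ |g| * q / 2 := by positivity
    linarith [neg_abs_le l]
  nlinarith [neg_abs_le g, abs_nonneg g]

/-- Weak limits of normalized unbounded sequences, along which a quadratic function with Legendre
quadratic part stays bounded above, are strong limits if the form is nonnegative at the limit. -/
theorem IsLegendreForm.tendsto_normalized {T : H →L[ℝ] H} (hT : IsLegendreForm T) {c : H}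
    {C : ℝ} {y : ℕ → H} (hnorm : Tendsto (fun n => ‖y n‖) atTop atTop)
    (hC : ∀ n, (1/2 : ℝ) * ⟪y n, T (y n)⟫ + ⟪c, y n⟫ ≤ C) {v : H}
    (hv : WeaklyConvergesTo (fun n => ‖y n‖⁻¹ • y n) v) (hnonneg : 0 ≤ ⟪v, T v⟫) :
    ⟪v, T v⟫ = 0 ∧ Tendsto (fun n => ‖y n‖⁻¹ • y n) atTop (𝓝 v) := by
  set u : ℕ → H := fun n => ‖y n‖⁻¹ • y n with hu
  have hinv : Tendsto (fun n => ‖y n‖⁻¹) atTop (𝓝 0) := tendsto_inv_atTop_zero.comp hnorm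
  have hub : ∀ n, ‖u n‖ ≤ 1 := fun n => by
    rw [hu]
    simp only [norm_smul, norm_inv, norm_norm]
    exact inv_mul_le_one
  have hupper : Tendsto (fun n => 2 * C * ‖y n‖⁻¹ ^ 2 - 2 * (‖y n‖⁻¹ * ⟪c, u n⟫)) atTop (𝓝 0) := by
    simpa using ((hinv.pow 2).const_mul (2 * C)).sub ((hinv.mul (hv c)).const_mul 2)
  have hle : ∀ n, ⟪u n, T (u n)⟫ ≤ 2 * C * ‖y n‖⁻¹ ^ 2 - 2 * (‖y n‖⁻¹ * ⟪c, u n⟫) := fun n => by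
    simp only [hu, map_smul, real_inner_smul_left, real_inner_smul_right]
    nlinarith [mul_le_mul_of_nonneg_left (hC n) (sq_nonneg ‖y n‖⁻¹)]
  have hzero : ⟪v, T v⟫ = 0 := by
    refine le_antisymm (le_of_forall_pos_le_add fun δ hδ => ?_) hnonneg
    have := ge_of_tendsto hupper ((hT.eventually_lt hv hub hδ).mono fun n hn => hn.le.trans (hle n))
    linarith
  refine ⟨hzero, hT.2 _ _ hv ?_⟩
  rw [hzero, tendsto_order]
  refine ⟨fun a ha => ?_, fun a ha => ?_⟩
  · filter_upwards [hT.eventually_lt hv hub (neg_pos.2 ha)] with n hn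
    linarith
  · filter_upwards [hupper.eventually (gt_mem_nhds ha)] with n hn
    exact (hle n).trans_lt hn

theorem eventually_norm_sub_lt_of_tendsto_normalized {y : ℕ → H}
    (hnorm : Tendsto (fun n => ‖y n‖) atTop atTop) {v : H}
    (hv : Tendsto (fun n => ‖y n‖⁻¹ • y n) atTop (𝓝 v)) :
    ∀ᶠ n in atTop, ‖y n - v‖ < ‖y n‖ := by
  have hv1 : ‖v‖ = 1 := by
    refine tendsto_nhds_unique hv.norm (tendsto_const_nhds.congr' ?_)
    filter_upwards [hnorm.eventually_gt_atTop 0] with n hn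
    rw [norm_smul, norm_inv, norm_norm, inv_mul_cancel₀ hn.ne']
  have hin : Tendsto (fun n => ⟪‖y n‖⁻¹ • y n, v⟫) atTop (𝓝 1) := by
    have := hv.inner (𝕜 := ℝ) (tendsto_const_nhds (x := v))
    rwa [real_inner_self_eq_norm_sq, hv1, one_pow] at this
  filter_upwards [hnorm.eventually_gt_atTop 1,
    hin.eventually (lt_mem_nhds (show (1/2 : ℝ) < 1 by norm_num))] with n hn hn2
  have h0 : 0 < ‖y n‖ := by linarith
  rw [real_inner_smul_left, inv_mul_eq_div, lt_div_iff₀ h0] at hn2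
  refine lt_of_pow_lt_pow_left₀ 2 (norm_nonneg _) ?_
  rw [norm_sub_sq_real, hv1]
  linarith

/-- Moving backwards along a recession direction that is the limit of the normalized sequence
eventually preserves a convex quadratic constraint. -/
theorem eventually_quadratic_sub_le_zero {S : H →L[ℝ] H}
    (hS : ∀ x y : H, ⟪S x, y⟫ = ⟪x, S y⟫) {b : H} {a : ℝ}
    {y : ℕ → H} (hy : ∀ n, (1/2 : ℝ) * ⟪y n, S (y n)⟫ + ⟪b, y n⟫ + a ≤ 0)
    (hnorm : Tendsto (fun n => ‖y n‖) atTop atTop) {v : H}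
    (hv : WeaklyConvergesTo (fun n => ‖y n‖⁻¹ • y n) v) (hSv : S v = 0)
    (hbv : S ≠ 0 → ⟪b, v⟫ = 0) :
    ∀ᶠ n in atTop, (1/2 : ℝ) * ⟪y n - v, S (y n - v)⟫ + ⟪b, y n - v⟫ + a ≤ 0 := by
  have h1 : ∀ n, ⟪y n - v, S (y n - v)⟫ = ⟪y n, S (y n)⟫ := fun n => by
    rw [map_sub, hSv, sub_zero, inner_sub_left, ← hS v, hSv, inner_zero_left, sub_zero]
  simp only [h1, inner_sub_right]
  rcases le_or_gt 0 ⟪b, v⟫ with hb | hb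
  · exact Eventually.of_forall fun n => by linarith [hy n]
  · have hS0 : S = 0 := by
      by_contra hne
      exact hb.ne (hbv hne)
    have h2 : Tendsto (fun n => ‖y n‖ * ⟪b, ‖y n‖⁻¹ • y n⟫) atTop atBot :=
      hnorm.atTop_mul_neg hb (hv b)
    filter_upwards [h2.eventually_le_atBot (⟪b, v⟫ - a), hnorm.eventually_gt_atTop 0]
      with n hn hn0
    rw [real_inner_smul_right, mul_inv_cancel_left₀ hn0.ne'] at hn
    simp only [hS0, zero_apply, inner_zero_right]
    linarith

end

/-- Eaves-type theorem: if `⟪x, T x⟫` is a Legendre form, `F` is nonempty,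
`⟪v, T v⟫ ≥ 0` for all `v ∈ 0⁺F`, `⟪T x + c, v⟫ ≥ 0` whenever `v ∈ 0⁺F`, `x ∈ F` and
`⟪v, T v⟫ = 0`, and condition (A) holds, then `f` attains its infimum on `F`. -/
theorem eaves_type
    {H : Type*} [NormedAddCommGroup H] [InnerProductSpace ℝ H] [CompleteSpace H]
    {m : ℕ} (T : H →L[ℝ] H) (hT_sa : ∀ x y : H, ⟪T x, y⟫ = ⟪x, T y⟫) (c : H)
    (Ti : Fin m → H →L[ℝ] H)
    (hTi_sa : ∀ i, ∀ x y : H, ⟪Ti i x, y⟫ = ⟪x, Ti i y⟫)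
    (hTi_pos : ∀ i, ∀ x : H, 0 ≤ ⟪x, Ti i x⟫)
    (ci : Fin m → H) (α : Fin m → ℝ)
    (f : H → ℝ) (hf : ∀ x, f x = (1/2 : ℝ) * ⟪x, T x⟫ + ⟪c, x⟫)
    (F : Set H)
    (hF : F = {x : H | ∀ i, (1/2 : ℝ) * ⟪x, Ti i x⟫ + ⟪ci i, x⟫ + α i ≤ 0})
    (hLeg : IsLegendreForm T)
    (hne : F.Nonempty)
    (hii : ∀ v ∈ recessionCone F, 0 ≤ ⟪v, T v⟫)
    (hiii : ∀ v ∈ recessionCone F, ∀ x ∈ F, ⟪v, T v⟫ = 0 → 0 ≤ ⟪T x + c, v⟫)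
    (hA : ∀ v ∈ recessionCone F, ⟪v, T v⟫ = 0 → ∀ i, Ti i ≠ 0 → ⟪ci i, v⟫ = 0)
    :
    ∃ xbar ∈ F, ∀ x ∈ F, f xbar ≤ f x := by
  have hmem : ∀ x, x ∈ F ↔ ∀ i, (1/2 : ℝ) * ⟪x, Ti i x⟫ + ⟪ci i, x⟫ + α i ≤ 0 := fun x => by
    rw [hF, Set.mem_ofPred_eq]
  have hconv : Convex ℝ F := by
    rw [hF, Set.ofPred_forall]
    exact convex_iInter fun i => convex_quadratic_le_zero (hTi_sa i) (hTi_pos i) _ _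
  have hclosed : ∀ (x : ℕ → H) (x₀ : H), WeaklyConvergesTo x x₀ → (∀ᶠ n in atTop, x n ∈ F) →
      x₀ ∈ F := fun x x₀ hx hxF =>
    (hmem _).2 fun i => quadratic_le_zero_of_weaklyConvergesTo (hTi_sa i) (hTi_pos i) hx
      (hxF.mono fun n hn => (hmem _).1 hn i)
  have hlsc : ∀ (x : ℕ → H) (x₀ : H), WeaklyConvergesTo x x₀ → ∀ R : ℝ, (∀ n, ‖x n‖ ≤ R) →
      ∀ δ > 0, ∀ᶠ n in atTop, f x₀ - δ < f (x n) := by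
    intro x x₀ hx R hR δ hδ
    filter_upwards [hLeg.eventually_lt hx hR hδ,
      (hx c).eventually (lt_mem_nhds (show ⟪c, x₀⟫ - δ / 2 < ⟪c, x₀⟫ by linarith))] with n h1 h2
    rw [hf, hf]
    linarith
  obtain ⟨z, hz⟩ := hne
  -- Minimizers of the penalized objective on the truncated feasible sets.
  have hpen : ∀ k : ℕ, ∃ x ∈ F ∩ Metric.closedBall 0 (‖z‖ + k),
      ∀ y ∈ F ∩ Metric.closedBall 0 (‖z‖ + k),
        f x + (1 / ((k : ℝ) + 1)) * ‖x‖ ^ 2 ≤ f y + (1 / ((k : ℝ) + 1)) * ‖y‖ ^ 2 := by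
    intro k
    have hε : 0 < 1 / ((k : ℝ) + 1) := by positivity
    set ε := 1 / ((k : ℝ) + 1)
    refine exists_forall_le_of_weakly_lsc (R := ‖z‖ + k) (h := fun x => f x + ε * ‖x‖ ^ 2)
      ⟨z, hz, by simp⟩ (fun x hx => by simpa using hx.2) ?_ ?_ ?_
    · exact fun x x₀ hx hxK => ⟨hclosed x x₀ hx (Eventually.of_forall fun n => (hxK n).1),
        by simpa using hx.norm_le fun n => by simpa using (hxK n).2⟩
    · refine ⟨-(‖T‖ * (‖z‖ + k) ^ 2) / 2 - ‖c‖ * (‖z‖ + k), ?_⟩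
      rintro _ ⟨x, hx, rfl⟩
      have hxR : ‖x‖ ≤ ‖z‖ + k := by simpa using hx.2
      have h1 := neg_le_inner_apply T hxR
      have h2 := neg_le_of_abs_le (abs_real_inner_le_norm c x)
      have h3 := mul_le_mul_of_nonneg_left hxR (norm_nonneg c)
      have h4 : 0 ≤ ε * ‖x‖ ^ 2 := by positivity
      simp only [hf]
      linarith
    · intro x x₀ hx hxK δ hδ
      filter_upwards [hlsc x x₀ hx (‖z‖ + k) (fun n => by simpa using (hxK n).2) (δ / 2)
        (by positivity), hx.eventually_lt_norm_sq (δ := δ / 2 / ε) (by positivity)] with n h1 h2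
      have h3 := mul_lt_mul_of_pos_left h2 hε
      rw [mul_sub, mul_div_cancel₀ _ hε.ne'] at h3
      linarith
  choose x hx hxmin using hpen
  by_cases hnorm : Tendsto (fun n => ‖x n‖) atTop atTop
  · exfalso
    obtain ⟨v, φ, hφ, hv⟩ := exists_subseq_weaklyConvergesTo (x := fun n => ‖x n‖⁻¹ • x n) (R := 1)
      fun n => by
        rw [norm_smul, norm_inv, norm_norm]
        exact inv_mul_le_one
    have hyn : Tendsto (fun n => ‖x (φ n)‖) atTop atTop := hnorm.comp hφ.tendsto_atTop
    have hyF : ∀ n, x (φ n) ∈ F := fun n => (hx _).1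
    have hvF : v ∈ recessionCone F :=
      mem_recessionCone_of_weaklyConvergesTo hconv hclosed hyF hyn hv
    have hfC : ∀ n, f (x n) ≤ f z + ‖z‖ ^ 2 := by
      intro n
      have h1 := hxmin n z ⟨hz, by simp⟩
      have h2 : 1 / ((n : ℝ) + 1) * ‖z‖ ^ 2 ≤ 1 * ‖z‖ ^ 2 := by
        gcongr
        rw [div_le_one (by positivity)]
        linarith [n.cast_nonneg (α := ℝ)]
      have h3 : 0 ≤ 1 / ((n : ℝ) + 1) * ‖x n‖ ^ 2 := by positivity
      linarith
    obtain ⟨hv0, hvs⟩ := hLeg.tendsto_normalized hyn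
      (fun n => by rw [← hf]; exact hfC (φ n)) hv (hii v hvF)
    have hsub : ∀ᶠ n in atTop, x (φ n) - v ∈ F := by
      simp only [hmem]
      refine eventually_all.2 fun i => eventually_quadratic_sub_le_zero (hTi_sa i)
        (fun n => (hmem _).1 (hyF n) i) hyn hv ?_ (hA v hvF hv0 i)
      exact apply_eq_zero_of_inner_eq_zero (hTi_sa i) (hTi_pos i)
        (inner_apply_eq_zero_of_mem_recessionCone (hTi_sa i) (hTi_pos i) ⟨z, hz⟩
          (fun y hy => (hmem y).1 hy i) hvF)
    obtain ⟨n, hnF, hnlt⟩ :=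
      (hsub.and (eventually_norm_sub_lt_of_tendsto_normalized hyn hvs)).exists
    have hball : ‖x (φ n)‖ ≤ ‖z‖ + φ n := by simpa using (hx (φ n)).2
    have hmin := hxmin (φ n) _ ⟨hnF, by simpa using hnlt.le.trans hball⟩
    have hfle : f (x (φ n) - v) ≤ f (x (φ n)) := by
      have h1 := hiii v hvF _ (hyF n) hv0
      have h2 := inner_add_smul_apply hT_sa (x (φ n)) v (-1)
      rw [neg_one_smul, ← sub_eq_add_neg, hv0] at h2
      rw [inner_add_left] at h1
      rw [hf, hf, h2, inner_sub_right]
      linarith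
    have hsq : ‖x (φ n) - v‖ ^ 2 < ‖x (φ n)‖ ^ 2 := by gcongr
    have := mul_lt_mul_of_pos_left hsq (show 0 < 1 / ((φ n : ℝ) + 1) by positivity)
    linarith
  · simp only [tendsto_atTop, not_forall, not_eventually, not_le] at hnorm
    obtain ⟨M, hM⟩ := hnorm
    obtain ⟨φ, hφ, hφM⟩ := extraction_of_frequently_atTop hM
    obtain ⟨x₀, ψ, hψ, hx₀⟩ := exists_subseq_weaklyConvergesTo (x := x ∘ φ) fun n => (hφM n).le
    refine ⟨x₀, hclosed _ _ hx₀ (Eventually.of_forall fun n => (hx _).1), fun y hy => ?_⟩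
    refine le_of_forall_pos_le_add fun δ hδ => ?_
    have hχ : Tendsto (fun n => φ (ψ n)) atTop atTop := (hφ.comp hψ).tendsto_atTop
    have hlim : Tendsto (fun n => f y + 1 / ((φ (ψ n) : ℝ) + 1) * ‖y‖ ^ 2) atTop (𝓝 (f y)) := by
      simpa using ((tendsto_one_div_add_atTop_nhds_zero_nat (𝕜 := ℝ)).comp hχ).mul_const
        (‖y‖ ^ 2) |>.const_add (f y)
    have hle : f x₀ - δ ≤ f y := by
      refine ge_of_tendsto hlim ?_
      filter_upwards [hlsc _ _ hx₀ M (fun n => (hφM _).le) δ hδ,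
        (tendsto_natCast_atTop_atTop (R := ℝ)).comp hχ |>.eventually_ge_atTop ‖y‖] with n h1 h2
      have h3 := hxmin (φ (ψ n)) y ⟨hy, by
        simp only [Function.comp_apply] at h2
        simpa using h2.trans (le_add_of_nonneg_left (norm_nonneg z))⟩
      have h4 : 0 ≤ 1 / ((φ (ψ n) : ℝ) + 1) * ‖x (φ (ψ n))‖ ^ 2 := by positivity
      simp only [Function.comp_apply] at h1
      linarith
    linarith
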